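/- There exists a constant c > 0, depending only on C0 and C1, such that for every δ > 0, every (C0,C1)-elliptic symmetric matrix γ and all η, ξ ∈ ℝ^{nN} with |η|_γ ≥ 1 + δ one has |η − ξ| ≤ c (1 + 1/δ) |G(γ,η) − G(γ,ξ)|. -/

import Mathlib

noncomputable section

open Real

/-- The `γ`-inner product on `ℝ^{nN}`. -/
def gInner {n N : ℕ} (γ : Matrix (Fin n) (Fin n) ℝ) (ξ η : Fin N → Fin n → ℝ) : ℝ :=
  ∑ i, ∑ α, ∑ β, γ α β * ξ i α * η i β

/-- The `γ`-norm on `ℝ^{nN}`. -/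
def gNorm {n N : ℕ} (γ : Matrix (Fin n) (Fin n) ℝ) (ξ : Fin N → Fin n → ℝ) : ℝ :=
  Real.sqrt (gInner γ ξ ξ)

/-- The Euclidean norm on `ℝ^{nN}`. -/
def eNorm {n N : ℕ} (ξ : Fin N → Fin n → ℝ) : ℝ :=
  Real.sqrt (∑ i, ∑ α, ξ i α ^ 2)

/-- A symmetric `(C0, C1)`-elliptic matrix. -/
def IsElliptic {n : ℕ} (C0 C1 : ℝ) (γ : Matrix (Fin n) (Fin n) ℝ) : Prop :=
  (∀ α β, γ α β = γ β α) ∧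
  ∀ ζ : Fin n → ℝ,
    C0 * ∑ α, ζ α ^ 2 ≤ (∑ α, ∑ β, γ α β * ζ α * ζ β) ∧
    (∑ α, ∑ β, γ α β * ζ α * ζ β) ≤ C1 * ∑ α, ζ α ^ 2

/-- `h(t) = (t-1)_+^{p-1} / t` (with the convention `h(0) = 0`). -/
def hfun (p t : ℝ) : ℝ := (max (t - 1) 0) ^ (p - 1) / t

/-- `g(t) = (t-1)_+^p / t`. -/
def gfun (p t : ℝ) : ℝ := (max (t - 1) 0) ^ p / t

/-- The derivative of `h` on `(1,∞)`, extended by `0` elsewhere. -/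
def hderiv (p s : ℝ) : ℝ :=
  if 1 < s then (s - 1) ^ (p - 2) * ((p - 2) * s + 1) / s ^ 2 else 0

/-- The derivative of `g` on `(1,∞)`, extended by `0` elsewhere. -/
def gderiv (p s : ℝ) : ℝ :=
  if 1 < s then (s - 1) ^ (p - 1) * ((p - 1) * s + 1) / s ^ 2 else 0

/-- `λ(t) = min{h(t), (p-1)(t-1)^{p-2}}` for `t > 1`, and `0` for `t ≤ 1`. -/
def lamFun (p t : ℝ) : ℝ :=
  if 1 < t then min (hfun p t) ((p - 1) * (t - 1) ^ (p - 2)) else 0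

/-- `Λ(t) = max{h(t), (p-1)(t-1)^{p-2}}` for `t > 1`, and `0` for `t ≤ 1`. -/
def LamFun (p t : ℝ) : ℝ :=
  if 1 < t then max (hfun p t) ((p - 1) * (t - 1) ^ (p - 2)) else 0

/-- The vector field `A_ε(γ, ξ) = h_ε(|ξ|_γ) ξ` (equal to `0` at `ξ = 0`). -/
def Avf {n N : ℕ} (p ε : ℝ) (γ : Matrix (Fin n) (Fin n) ℝ) (ξ : Fin N → Fin n → ℝ) :
    Fin N → Fin n → ℝ :=
  fun i α => (hfun p (gNorm γ ξ) + ε) * ξ i α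

/-- The map `G_δ(γ, ξ) = ((|ξ|_γ - 1 - δ)_+ / |ξ|_γ) ξ` (equal to `0` at `ξ = 0`). -/
def Gmap {n N : ℕ} (δ : ℝ) (γ : Matrix (Fin n) (Fin n) ℝ) (ξ : Fin N → Fin n → ℝ) :
    Fin N → Fin n → ℝ :=
  fun i α => (max (gNorm γ ξ - 1 - δ) 0) / gNorm γ ξ * ξ i α

/-- The bilinear form `𝒜_ε(γ, ξ)` on third-order tensors in `ℝ^{n²N}`. -/
def Aform {n N : ℕ} (p ε : ℝ) (γ : Matrix (Fin n) (Fin n) ℝ) (ξ : Fin N → Fin n → ℝ)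
    (η ζ : Fin N → Fin n → Fin n → ℝ) : ℝ :=
  ∑ i, ∑ j, ∑ α, ∑ β, ∑ ν, ∑ σ,
    ((hfun p (gNorm γ ξ) + ε) * γ α β * (if i = j then (1 : ℝ) else 0) +
        hderiv p (gNorm γ ξ) / gNorm γ ξ *
          (∑ d, γ α d * ξ i d) * (∑ k, γ β k * ξ j k)) *
      γ ν σ * η i α ν * ζ j β σ

/-- The bilinear form `ℬ_ε(γ, ξ)` on `ℝ^{nN}`. -/
def Bform {n N : ℕ} (p ε : ℝ) (γ : Matrix (Fin n) (Fin n) ℝ) (ξ : Fin N → Fin n → ℝ)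
    (η ζ : Fin N → Fin n → ℝ) : ℝ :=
  ∑ i, ∑ j, ∑ α, ∑ β,
    ((hfun p (gNorm γ ξ) + ε) * γ α β * (if i = j then (1 : ℝ) else 0) +
        hderiv p (gNorm γ ξ) / gNorm γ ξ *
          (∑ d, γ α d * ξ i d) * (∑ k, γ β k * ξ j k)) *
      η i α * ζ j β

/-- The bilinear form `𝒞_ε(γ, ξ)` on `ℝ^n`. -/
def Cform {n N : ℕ} (p ε : ℝ) (γ : Matrix (Fin n) (Fin n) ℝ) (ξ : Fin N → Fin n → ℝ)
    (ζ ζ' : Fin n → ℝ) : ℝ :=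
  ∑ α, ∑ β,
    ((hfun p (gNorm γ ξ) + ε) * γ α β +
        hderiv p (gNorm γ ξ) / gNorm γ ξ *
          (∑ i, (∑ d, γ α d * ξ i d) * (∑ k, γ β k * ξ i k))) *
      ζ α * ζ' β

/-- The squared `γ`-norm of a third-order tensor in `ℝ^{n²N}`. -/
def tNormSq {n N : ℕ} (γ : Matrix (Fin n) (Fin n) ℝ) (η : Fin N → Fin n → Fin n → ℝ) : ℝ :=
  ∑ i, ∑ α, ∑ β, ∑ ν, ∑ σ, γ α β * γ ν σ * η i α ν * η i β σ

lemma eNorm_sq {n N : ℕ} (ξ : Fin N → Fin n → ℝ) : eNorm ξ ^ 2 = ∑ i, ∑ α, ξ i α ^ 2 :=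
  Real.sq_sqrt (Finset.sum_nonneg fun _ _ => Finset.sum_nonneg fun _ _ => sq_nonneg _)

lemma IsElliptic.mul_eNorm_sq_le {n N : ℕ} {C0 C1 : ℝ} {γ : Matrix (Fin n) (Fin n) ℝ}
    (h : IsElliptic C0 C1 γ) (ξ : Fin N → Fin n → ℝ) : C0 * eNorm ξ ^ 2 ≤ gInner γ ξ ξ := by
  rw [eNorm_sq, Finset.mul_sum]
  exact Finset.sum_le_sum fun i _ => (h.2 (ξ i)).1

lemma IsElliptic.gInner_self_le {n N : ℕ} {C0 C1 : ℝ} {γ : Matrix (Fin n) (Fin n) ℝ}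
    (h : IsElliptic C0 C1 γ) (ξ : Fin N → Fin n → ℝ) : gInner γ ξ ξ ≤ C1 * eNorm ξ ^ 2 := by
  rw [eNorm_sq, Finset.mul_sum]
  exact Finset.sum_le_sum fun i _ => (h.2 (ξ i)).2

lemma gInner_comm {n N : ℕ} {γ : Matrix (Fin n) (Fin n) ℝ} (h : ∀ α β, γ α β = γ β α)
    (ξ η : Fin N → Fin n → ℝ) : gInner γ ξ η = gInner γ η ξ := by
  refine Finset.sum_congr rfl fun i _ => ?_
  rw [Finset.sum_comm]
  refine Finset.sum_congr rfl fun α _ => Finset.sum_congr rfl fun β _ => ?_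
  rw [h β α]
  ring

/-- Expansion of the quadratic form `⟨·, ·⟩_γ` on a linear combination. -/
lemma gInner_self_combination {n N : ℕ} {γ : Matrix (Fin n) (Fin n) ℝ}
    (h : ∀ α β, γ α β = γ β α) (x y : ℝ) (η ξ : Fin N → Fin n → ℝ) :
    gInner γ (fun i α => x * η i α - y * ξ i α) (fun i α => x * η i α - y * ξ i α) =
      x ^ 2 * gInner γ η η - 2 * (x * y) * gInner γ η ξ + y ^ 2 * gInner γ ξ ξ := by
  have key : gInner γ (fun i α => x * η i α - y * ξ i α) (fun i α => x * η i α - y * ξ i α) =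
      x ^ 2 * gInner γ η η - (x * y) * gInner γ η ξ - (x * y) * gInner γ ξ η
        + y ^ 2 * gInner γ ξ ξ := by
    simp only [gInner, Finset.mul_sum, ← Finset.sum_sub_distrib, ← Finset.sum_add_distrib]
    refine Finset.sum_congr rfl fun i _ => Finset.sum_congr rfl fun α _ =>
      Finset.sum_congr rfl fun β _ => ?_
    ring
  rw [key, gInner_comm h ξ η]
  ring

lemma IsElliptic.gInner_self_nonneg {n N : ℕ} {C0 C1 : ℝ} (hC0 : 0 ≤ C0)
    {γ : Matrix (Fin n) (Fin n) ℝ} (h : IsElliptic C0 C1 γ) (ξ : Fin N → Fin n → ℝ) :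
    0 ≤ gInner γ ξ ξ :=
  (mul_nonneg hC0 (sq_nonneg _)).trans (h.mul_eNorm_sq_le ξ)

lemma IsElliptic.gNorm_sq {n N : ℕ} {C0 C1 : ℝ} (hC0 : 0 ≤ C0)
    {γ : Matrix (Fin n) (Fin n) ℝ} (h : IsElliptic C0 C1 γ) (ξ : Fin N → Fin n → ℝ) :
    gNorm γ ξ ^ 2 = gInner γ ξ ξ :=
  Real.sq_sqrt (h.gInner_self_nonneg hC0 ξ)

/-- The Cauchy–Schwarz inequality for `⟨·, ·⟩_γ`. -/
lemma IsElliptic.abs_gInner_le {n N : ℕ} {C0 C1 : ℝ} (hC0 : 0 ≤ C0)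
    {γ : Matrix (Fin n) (Fin n) ℝ} (h : IsElliptic C0 C1 γ) (η ξ : Fin N → Fin n → ℝ) :
    |gInner γ η ξ| ≤ gNorm γ η * gNorm γ ξ := by
  have hd : discrim (gInner γ η η) (-2 * gInner γ η ξ) (gInner γ ξ ξ) ≤ 0 := by
    refine discrim_le_zero fun t => ?_
    have := h.gInner_self_nonneg hC0 (fun i α => t * η i α - 1 * ξ i α)
    rw [gInner_self_combination h.1] at this
    linarith
  refine abs_le_of_sq_le_sq ?_ (mul_nonneg (Real.sqrt_nonneg _) (Real.sqrt_nonneg _))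
  rw [mul_pow, h.gNorm_sq hC0, h.gNorm_sq hC0]
  unfold discrim at hd
  linarith

lemma sub_mul_nonpos_of_abs_le {A B s m : ℝ} (hs : |s| ≤ m) (h₁ : A - B * m ≤ 0)
    (h₂ : A + B * m ≤ 0) : A - B * s ≤ 0 := by
  obtain ⟨hl, hu⟩ := abs_le.mp hs
  rcases le_total 0 B with hB | hB <;> nlinarith

/-- The estimate for collinear vectors with the same or with opposite orientation. -/
lemma abs_sub_le_and_add_le_of_truncation {a b δ : ℝ} (hδ : 0 < δ) (ha : 1 + δ ≤ a)
    (hb : 0 ≤ b) :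
    |a - b| ≤ (1 + 2 / δ) * |a - 1 - max (b - 1) 0| ∧
      a + b ≤ (1 + 2 / δ) * (a - 1 + max (b - 1) 0) := by
  have hk : 0 < 2 / δ := by positivity
  have hkδ : 2 / δ * δ = 2 := by field_simp
  rcases le_total b 1 with hb1 | hb1
  · rw [max_eq_right (by linarith), sub_zero, abs_of_nonneg (by linarith),
      abs_of_nonneg (by linarith)]
    constructor <;> nlinarith
  · rw [max_eq_left (by linarith)]
    constructor
    · rw [show a - 1 - (b - 1) = a - b by ring]
      nlinarith [abs_nonneg (a - b)]
    · nlinarith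

lemma IsElliptic.gInner_sub_le_gInner_Gmap_sub {n N : ℕ} {C0 C1 δ : ℝ} (hC0 : 0 ≤ C0)
    (hδ : 0 < δ) {γ : Matrix (Fin n) (Fin n) ℝ} (h : IsElliptic C0 C1 γ)
    (η ξ : Fin N → Fin n → ℝ) (hη : 1 + δ ≤ gNorm γ η) :
    gInner γ (fun i α => η i α - ξ i α) (fun i α => η i α - ξ i α) ≤
      (1 + 2 / δ) ^ 2 *
        gInner γ (fun i α => Gmap 0 γ η i α - Gmap 0 γ ξ i α)
          (fun i α => Gmap 0 γ η i α - Gmap 0 γ ξ i α) := by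
  have hE := gInner_self_combination h.1 1 1 η ξ
  simp only [one_mul] at hE
  rw [hE]
  unfold Gmap
  rw [gInner_self_combination h.1, ← h.gNorm_sq hC0 η, ← h.gNorm_sq hC0 ξ]
  have hs := h.abs_gInner_le hC0 η ξ
  have hb : 0 ≤ gNorm γ ξ := Real.sqrt_nonneg _
  generalize gNorm γ η = a at *
  generalize gNorm γ ξ = b at *
  generalize gInner γ η ξ = s at *
  have hp : max (a - 1 - 0) 0 / a * a = a - 1 := by
    rw [div_mul_cancel₀ _ (by linarith), max_eq_left (by linarith), sub_zero]
  have hq : max (b - 1 - 0) 0 / b * b = max (b - 1) 0 := by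
    rcases hb.eq_or_lt with rfl | hb
    · simp
    · rw [div_mul_cancel₀ _ hb.ne', sub_zero]
  obtain ⟨h₁, h₂⟩ := abs_sub_le_and_add_le_of_truncation hδ hη hb
  rw [← hp, ← hq] at h₁ h₂
  generalize max (a - 1 - 0) 0 / a = p at *
  generalize max (b - 1 - 0) 0 / b = q at *
  have h₁' := pow_le_pow_left₀ (abs_nonneg _) h₁ 2
  have h₂' := pow_le_pow_left₀ (by linarith) h₂ 2
  rw [mul_pow, sq_abs, sq_abs] at h₁'
  generalize 1 + 2 / δ = K at *
  have := sub_mul_nonpos_of_abs_le (A := a ^ 2 + b ^ 2 - K ^ 2 * ((p * a) ^ 2 + (q * b) ^ 2))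
    (B := 2 - 2 * K ^ 2 * (p * q)) hs (by linarith) (by linarith)
  linarith

/-- second part of Lemma `lem3`. -/
theorem statement3 (C0 C1 : ℝ) (hC0 : 0 < C0) (hC01 : C0 ≤ C1) :
    ∃ c : ℝ, 0 < c ∧
      ∀ (n N : ℕ), 1 ≤ n → 1 ≤ N →
        ∀ δ : ℝ, 0 < δ →
          ∀ γ : Matrix (Fin n) (Fin n) ℝ, IsElliptic C0 C1 γ →
            ∀ η ξ : Fin N → Fin n → ℝ, 1 + δ ≤ gNorm γ η →
              eNorm (fun i α => η i α - ξ i α) ≤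
                c * (1 + 1 / δ) * eNorm (fun i α => Gmap 0 γ η i α - Gmap 0 γ ξ i α) := by
  refine ⟨2 * √(C1 / C0), by have := hC0.trans_le hC01; positivity, ?_⟩
  intro n N _ _ δ hδ γ hγ η ξ hη
  have hC1 : 0 < C1 := hC0.trans_le hC01
  refine le_of_sq_le_sq ?_ (mul_nonneg (by positivity) (Real.sqrt_nonneg _))
  have hlow := hγ.mul_eNorm_sq_le (fun i α => η i α - ξ i α)
  have hmid := hγ.gInner_sub_le_gInner_Gmap_sub hC0.le hδ η ξ hη
  have hup := hγ.gInner_self_le (fun i α => Gmap 0 γ η i α - Gmap 0 γ ξ i α)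
  have hK : (1 + 2 / δ) ^ 2 ≤ (2 * (1 + 1 / δ)) ^ 2 := by
    refine pow_le_pow_left₀ (by positivity) ?_ 2
    rw [mul_add, mul_one_div]
    linarith
  generalize eNorm (fun i α => Gmap 0 γ η i α - Gmap 0 γ ξ i α) = e at *
  rw [mul_pow, mul_pow, mul_pow, Real.sq_sqrt (by positivity), ← mul_le_mul_iff_right₀ hC0]
  calc _ ≤ (1 + 2 / δ) ^ 2 * (C1 * e ^ 2) :=
        hlow.trans (hmid.trans (mul_le_mul_of_nonneg_left hup (sq_nonneg _)))
    _ ≤ (2 * (1 + 1 / δ)) ^ 2 * (C1 * e ^ 2) := mul_le_mul_of_nonneg_right hK (by positivity)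
    _ = _ := by field_simp
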